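/- The set of maps with infinite topological entropy is residual in (CP, ρ) and residual in (cl(CP), ρ). -/

import Mathlib

open Set Function Metric Dynamics

/-- The unit interval `[0,1]` with the Euclidean metric. -/
abbrev unitI : Type := Set.Icc (0:ℝ) 1

/-- `CP`: continuous surjective self-maps of `I` with a dense set of periodic points.
The ambient space `C(I,I)` carries the uniform (sup) metric. -/
def CP : Set C(unitI, unitI) :=
  {f | Function.Surjective ⇑f ∧ Dense (Function.periodicPts ⇑f)}

/-- Topological entropy of a self-map of `I` (cover entropy with respect to the
natural uniformity on `I`). -/
noncomputable def hTop (f : unitI → unitI) : EReal :=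
  Dynamics.coverEntropy f Set.univ

/-- Maps having `m` pairwise separated intervals `[x i, y i] ⊆ [c, d]`, each of which is stretched
strictly over `[c, d]`. -/
def horseshoeMaps (m : ℕ) : Set C(unitI, unitI) :=
  {f | ∃ (c d : unitI) (x y : ℕ → unitI), ∀ i < m, c ≤ x i ∧ x i ≤ y i ∧ y i ≤ d ∧
    y i < x (i + 1) ∧ f (x i) < c ∧ d < f (y i)}

/-- Maps some positive iterate of which crosses the diagonal strictly between two points of
`(a, b)`. -/
def crossingMaps (a b : ℝ) : Set C(unitI, unitI) :=
  {f | ∃ (n : ℕ) (x y : unitI), 0 < n ∧ a < x ∧ x < b ∧ a < y ∧ y < b ∧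
    f^[n] x < x ∧ y < f^[n] y}

theorem continuous_iterate_apply (n : ℕ) (x : unitI) :
    Continuous fun f : C(unitI, unitI) => f^[n] x := by
  induction n with
  | zero => exact continuous_const
  | succ n ih =>
    simp only [Function.iterate_succ_apply']
    exact continuous_id.eval ih

theorem isOpen_horseshoeMaps (m : ℕ) : IsOpen (horseshoeMaps m) := by
  simp only [horseshoeMaps, ofPred_exists]
  refine isOpen_iUnion fun c => isOpen_iUnion fun d => isOpen_iUnion fun x =>
    isOpen_iUnion fun y => ?_
  have : {f : C(unitI, unitI) | ∀ i < m, c ≤ x i ∧ x i ≤ y i ∧ y i ≤ d ∧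
      y i < x (i + 1) ∧ f (x i) < c ∧ d < f (y i)} =
      ⋂ i ∈ Set.Iio m, {f : C(unitI, unitI) | c ≤ x i ∧ x i ≤ y i ∧ y i ≤ d ∧
      y i < x (i + 1) ∧ f (x i) < c ∧ d < f (y i)} := by
    ext f; simp
  rw [this]
  refine (Set.finite_Iio m).isOpen_biInter fun i _ => ?_
  refine isOpen_const.inter (isOpen_const.inter (isOpen_const.inter (isOpen_const.inter ?_)))
  exact (isOpen_lt (α := unitI) (continuous_iterate_apply 1 (x i)) continuous_const).inter
    (isOpen_lt (α := unitI) continuous_const (continuous_iterate_apply 1 (y i)))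

theorem isOpen_crossingMaps (a b : ℝ) : IsOpen (crossingMaps a b) := by
  simp only [crossingMaps, ofPred_exists]
  refine isOpen_iUnion fun n => isOpen_iUnion fun x => isOpen_iUnion fun y => ?_
  refine isOpen_const.inter (isOpen_const.inter (isOpen_const.inter (isOpen_const.inter
    (isOpen_const.inter ?_))))
  exact (isOpen_lt (continuous_iterate_apply n x) continuous_const).inter
    (isOpen_lt (α := unitI) continuous_const (continuous_iterate_apply n y))

theorem exists_periodicPt_of_mem_crossingMaps {a b : ℝ} {f : C(unitI, unitI)}
    (hf : f ∈ crossingMaps a b) : ∃ z ∈ periodicPts f, a < (z : ℝ) ∧ (z : ℝ) < b := by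
  obtain ⟨n, x, y, hn, hax, hxb, hay, hyb, hx, hy⟩ := hf
  obtain ⟨z, hz, hfz⟩ := exists_mem_uIcc_isFixedPt (a := y) (b := x) (f := f^[n])
    (f.continuous.iterate n).continuousOn hy.le hx.le
  refine ⟨z, ⟨n, hn, hfz⟩, ?_⟩
  rw [Set.mem_uIcc] at hz
  rcases hz with ⟨h1, h2⟩ | ⟨h1, h2⟩
  · exact ⟨hay.trans_le h1, lt_of_le_of_lt (show (z : ℝ) ≤ x from h2) hxb⟩
  · exact ⟨hax.trans_le h1, lt_of_le_of_lt (show (z : ℝ) ≤ y from h2) hyb⟩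

/-- A dense subset of `[0,1]` meets every open subinterval. -/
theorem exists_mem_between_of_dense {s : Set unitI} (hs : Dense s) {a b : ℝ} (ha : 0 ≤ a)
    (hab : a < b) (hb : b ≤ 1) : ∃ z ∈ s, a < (z : ℝ) ∧ (z : ℝ) < b := by
  have ho : IsOpen {z : unitI | a < (z : ℝ) ∧ (z : ℝ) < b} :=
    (isOpen_lt continuous_const continuous_subtype_val).inter
      (isOpen_lt continuous_subtype_val continuous_const)
  obtain ⟨z, hz, hzs⟩ := hs.inter_open_nonempty _ ho
    ⟨⟨(a + b) / 2, by constructor <;> linarith⟩, by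
      constructor <;> simp only <;> linarith⟩
  exact ⟨z, hzs, hz⟩

theorem exists_rat_interval_subset {U : Set unitI} (hU : IsOpen U) (hne : U.Nonempty) :
    ∃ a b : ℚ, 0 ≤ a ∧ a < b ∧ b ≤ 1 ∧ ∀ z : unitI, (a : ℝ) < z → (z : ℝ) < b → z ∈ U := by
  obtain ⟨x, hx⟩ := hne
  obtain ⟨ε, hε, hball⟩ := Metric.isOpen_iff.1 hU x hx
  have hx0 := x.2.1
  have hx1 := x.2.2
  have hlt : max 0 ((x : ℝ) - ε) < min 1 ((x : ℝ) + ε) := by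
    apply max_lt <;> apply lt_min <;> linarith
  obtain ⟨a, ha1, ha2⟩ := exists_rat_btwn hlt
  obtain ⟨b, hb1, hb2⟩ := exists_rat_btwn ha2
  refine ⟨a, b, ?_, by exact_mod_cast hb1, ?_, fun z hz1 hz2 => hball ?_⟩
  · have := (le_max_left _ _).trans ha1.le
    exact_mod_cast this
  · have := hb2.le.trans (min_le_left _ _)
    exact_mod_cast this
  · have h1 := (le_max_right _ _).trans ha1.le
    have h2 := hb2.le.trans (min_le_right _ _)
    rw [Metric.mem_ball, Subtype.dist_eq, Real.dist_eq, abs_lt]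
    constructor <;> linarith

theorem mem_CP_of_forall_mem_crossingMaps {f : C(unitI, unitI)}
    (hf : ∀ a b : ℚ, 0 ≤ a → a < b → b ≤ 1 → f ∈ crossingMaps a b) : f ∈ CP := by
  have hd : Dense (periodicPts f) := by
    rw [dense_iff_inter_open]
    intro U hU hne
    obtain ⟨a, b, ha, hab, hb, hsub⟩ := exists_rat_interval_subset hU hne
    obtain ⟨z, hz, h1, h2⟩ := exists_periodicPt_of_mem_crossingMaps (hf a b ha hab hb)
    exact ⟨z, hsub z h1 h2, hz⟩
  refine ⟨?_, hd⟩
  have hsub : periodicPts f ⊆ range f := by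
    rintro z ⟨n, hn, hz⟩
    obtain ⟨k, rfl⟩ := Nat.exists_eq_succ_of_ne_zero hn.ne'
    exact ⟨f^[k] z, (Function.iterate_succ_apply' f k z).symm.trans hz⟩
  have hc : IsClosed (range f) := (isCompact_range f.continuous).isClosed
  rw [← Set.range_eq_univ, ← hc.closure_eq]
  exact (hd.mono hsub).closure_eq

theorem exists_itinerary {f : C(unitI, unitI)} {m : ℕ} {c d : unitI} {x y : ℕ → unitI}
    (hcd : c ≤ d)
    (h : ∀ i < m, c ≤ x i ∧ x i ≤ y i ∧ y i ≤ d ∧ y i < x (i + 1) ∧ f (x i) < c ∧ d < f (y i))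
    (n : ℕ) (w : ℕ → ℕ) (hw : ∀ i, w i < m) :
    ∃ z ∈ Icc c d, ∀ i < n, f^[i] z ∈ Icc (x (w i)) (y (w i)) := by
  induction n generalizing w with
  | zero => exact ⟨c, ⟨le_rfl, hcd⟩, by simp⟩
  | succ n ih =>
    obtain ⟨z, hz, hzw⟩ := ih (fun i => w (i + 1)) fun i => hw (i + 1)
    obtain ⟨h1, h2, h3, -, h5, h6⟩ := h (w 0) (hw 0)
    obtain ⟨z', hz', rfl⟩ := intermediate_value_Icc h2 f.continuous.continuousOn
      (show z ∈ Icc (f (x (w 0))) (f (y (w 0))) from ⟨h5.le.trans hz.1, hz.2.trans h6.le⟩)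
    refine ⟨z', ⟨h1.trans hz'.1, hz'.2.trans h3⟩, fun i hi => ?_⟩
    cases i with
    | zero => exact hz'
    | succ i => exact hzw i (by omega)

theorem log_le_hTop_of_mem_horseshoeMaps {f : C(unitI, unitI)} {m : ℕ} (hm : 0 < m)
    (hf : f ∈ horseshoeMaps m) : ENNReal.log m ≤ hTop f := by
  classical
  obtain ⟨c, d, x, y, h⟩ := hf
  have hcd : c ≤ d := (h 0 hm).1.trans ((h 0 hm).2.1.trans (h 0 hm).2.2.1)
  obtain ⟨δ, hδ, hgap⟩ : ∃ δ > 0, ∀ i < m, δ ≤ (x (i + 1) : ℝ) - y i := by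
    have hne : (Finset.range m).Nonempty := ⟨0, by simpa using hm⟩
    obtain ⟨i, hi, hmin⟩ := (Finset.range m).exists_min_image
      (fun i => (x (i + 1) : ℝ) - y i) hne
    refine ⟨_, sub_pos.2 (h i (by simpa using hi)).2.2.2.1, fun j hj => hmin j (by simpa using hj)⟩
  have hmono : ∀ i j, i ≤ j → j < m → x i ≤ x j := by
    intro i j hij
    induction j, hij using Nat.le_induction with
    | base => intro _; exact le_rfl
    | succ j hij ih =>
      intro hj
      obtain ⟨-, h2, -, h4, -⟩ := h j (by omega)
      exact (ih (by omega)).trans (h2.trans h4.le)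
  have hsep : ∀ i j, i < j → j < m → ∀ p ∈ Icc (x i) (y i), ∀ q ∈ Icc (x j) (y j),
      δ ≤ (q : ℝ) - p := by
    intro i j hij hj p hp q hq
    have h1 : (p : ℝ) ≤ y i := hp.2
    have h2 : (x j : ℝ) ≤ q := hq.1
    have h3 : (x (i + 1) : ℝ) ≤ x j := hmono _ _ hij hj
    linarith [hgap i (by omega)]
  have hsep' : ∀ i j, i ≠ j → i < m → j < m → ∀ p ∈ Icc (x i) (y i), ∀ q ∈ Icc (x j) (y j),
      δ ≤ dist p q := by
    intro i j hij hi hj p hp q hq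
    rw [Subtype.dist_eq, Real.dist_eq]
    rcases lt_or_gt_of_ne hij with hij | hij
    · rw [abs_sub_comm]; exact (hsep i j hij hj p hp q hq).trans (le_abs_self _)
    · exact (hsep j i hij hi q hq p hp).trans (le_abs_self _)
  let U : Set (unitI × unitI) := {p | dist p.1 p.2 < δ / 2}
  have hU : U ∈ uniformity unitI := Metric.dist_mem_uniformity (by positivity)
  refine le_trans ?_ (netEntropyEntourage_le_coverEntropy f univ hU)
  rw [← ExpGrowth.expGrowthSup_pow]
  refine ExpGrowth.expGrowthSup_monotone fun n => ?_
  choose z hz hzw using fun w : Fin n → Fin m =>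
    exists_itinerary hcd h n (fun i => if hi : i < n then w ⟨i, hi⟩ else 0)
      (fun i => by split_ifs <;> simp [hm])
  have hdisj : ∀ w w' : Fin n → Fin m, w ≠ w' →
      Disjoint (UniformSpace.ball (z w) (dynEntourage f U n))
        (UniformSpace.ball (z w') (dynEntourage f U n)) := by
    intro w w' hne
    obtain ⟨i, hi⟩ := Function.ne_iff.1 hne
    rw [Set.disjoint_left]
    intro p hp hp'
    rw [mem_ball_dynEntourage] at hp hp'
    have h1 : dist (f^[i] (z w)) (f^[i] p) < δ / 2 := hp i i.2
    have h2 : dist (f^[i] (z w')) (f^[i] p) < δ / 2 := hp' i i.2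
    have h3 := hzw w i i.2
    have h4 := hzw w' i i.2
    simp only [Fin.is_lt, dite_true, Fin.eta] at h3 h4
    have h5 := hsep' _ _ (fun h => hi (Fin.ext h)) (w i).2 (w' i).2 _ h3 _ h4
    have h6 := dist_triangle_right (f^[i] (z w)) (f^[i] (z w')) (f^[i] p)
    linarith
  have hinj : Function.Injective z := by
    intro w w' hww
    by_contra hne
    have := hdisj w w' hne
    rw [hww, disjoint_self, Set.bot_eq_empty] at this
    have hmem : z w' ∈ UniformSpace.ball (z w') (dynEntourage f U n) := by
      rw [mem_ball_dynEntourage]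
      intro k _
      change dist _ _ < δ / 2
      simpa using hδ
    rw [this] at hmem
    exact hmem
  have hnet : IsDynNetIn f univ U n (Finset.univ.image z : Finset unitI) := by
    refine ⟨Set.subset_univ _, ?_⟩
    simp only [Finset.coe_image, Finset.coe_univ, Set.image_univ]
    rintro _ ⟨w, rfl⟩ _ ⟨w', rfl⟩ hne
    exact hdisj w w' fun h => hne (by rw [h])
  have hcard := hnet.card_le_netMaxcard
  rw [Finset.card_image_of_injective _ hinj] at hcard
  simp only [Finset.card_univ, Fintype.card_fun, Fintype.card_fin] at hcard
  have := ENat.toENNReal_mono hcard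
  simpa using this

theorem hTop_eq_top_of_forall_mem_horseshoeMaps {f : C(unitI, unitI)}
    (hf : ∀ m, f ∈ horseshoeMaps m) : hTop f = ⊤ := by
  have h : ∀ m : ℕ, ENNReal.log m ≤ hTop f := fun m => by
    rcases Nat.eq_zero_or_pos m with rfl | hm
    · simp
    · exact log_le_hTop_of_mem_horseshoeMaps hm (hf m)
  have ht : Filter.Tendsto (fun m : ℕ => ENNReal.log m) Filter.atTop (nhds ⊤) := by
    rw [← ENNReal.log_top]
    exact (ENNReal.continuous_log.tendsto _).comp ENNReal.tendsto_nat_nhds_top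
  exact top_le_iff.1 (le_of_tendsto' ht h)

/-- The piecewise linear function with value `v k` at `k` for every natural number `k ≤ K`. -/
noncomputable def piecewiseLinear (v : ℕ → ℝ) (K : ℕ) (t : ℝ) : ℝ :=
  v 0 + ∑ k ∈ Finset.range K, (v (k + 1) - v k) * max 0 (min 1 (t - k))

theorem continuous_piecewiseLinear (v : ℕ → ℝ) (K : ℕ) : Continuous (piecewiseLinear v K) := by
  unfold piecewiseLinear
  fun_prop

theorem piecewiseLinear_of_le (v : ℕ → ℝ) {K : ℕ} {t : ℝ} (h : (K : ℝ) ≤ t) :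
    piecewiseLinear v K t = v K := by
  induction K with
  | zero => simp [piecewiseLinear]
  | succ K ih =>
    push_cast at h
    have ih := ih (by linarith)
    unfold piecewiseLinear at ih ⊢
    rw [Finset.sum_range_succ, ← add_assoc, ih, min_eq_left (by linarith),
      max_eq_right zero_le_one]
    ring

theorem piecewiseLinear_eq (v : ℕ → ℝ) {K k : ℕ} (hk : k < K) {t : ℝ} (h1 : (k : ℝ) ≤ t)
    (h2 : t ≤ k + 1) : piecewiseLinear v K t = v k + (v (k + 1) - v k) * (t - k) := by
  induction K, (show k + 1 ≤ K from hk) using Nat.le_induction with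
  | base =>
    have h := piecewiseLinear_of_le v h1
    unfold piecewiseLinear at h ⊢
    rw [Finset.sum_range_succ, ← add_assoc, h, min_eq_right (by linarith),
      max_eq_right (by linarith)]
  | succ K hK ih =>
    have h := ih hK
    have hK' : (k : ℝ) + 1 ≤ K := by exact_mod_cast hK
    unfold piecewiseLinear at h ⊢
    rw [Finset.sum_range_succ, ← add_assoc, h,
      max_eq_left ((min_le_right _ _).trans (by linarith)), mul_zero, add_zero]

/-- Twice the values of the zigzag at the points `k / M`. On the cell `[i, i + 1]` the values
oscillate between `α i` and `β i`, except near the ends of the cell, where they connect to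
the neighbouring cells. -/
def doubledValue (M : ℕ) (α β : ℕ → ℕ) (k : ℕ) : ℕ :=
  if k % M = 0 then 2 * max (α (k / M - 1)) (α (k / M))
  else if k % M = 1 ∨ k % M + 1 = M then 2 * α (k / M) + 1
  else if k % M % 2 = 0 then 2 * α (k / M)
  else 2 * β (k / M)

/-- The piecewise linear map of `[0, N]` sending each cell `[i, i + 1]` onto `[α i, β i]` with
about `M` monotone pieces. -/
noncomputable def zigzag (N M : ℕ) (α β : ℕ → ℕ) (t : ℝ) : ℝ :=
  piecewiseLinear (fun k => (doubledValue M α β k : ℝ) / 2) (N * M) (M * t)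

/-- The conditions on the target intervals `[α i, β i]` ensuring that neighbouring pieces of a
zigzag can be glued. -/
structure Gluable (N : ℕ) (α β : ℕ → ℕ) : Prop where
  lt : ∀ i, α i < β i
  le_card : ∀ i, β i ≤ N
  le_succ : ∀ i, α i ≤ β (i + 1)
  succ_le : ∀ i, α (i + 1) ≤ β i

/-- The cell `j` lies in the target interval of the cell `i`. -/
def Covers (N : ℕ) (α β : ℕ → ℕ) (i j : ℕ) : Prop := i < N ∧ α i ≤ j ∧ j < β i

theorem Covers.lt_card {N : ℕ} {α β : ℕ → ℕ} (h : Gluable N α β) {i j : ℕ}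
    (hij : Covers N α β i j) : j < N := hij.2.2.trans_le (h.le_card i)

theorem continuous_zigzag (N M : ℕ) (α β : ℕ → ℕ) : Continuous (zigzag N M α β) :=
  (continuous_piecewiseLinear _ _).comp (continuous_const.mul continuous_id)

theorem doubledValue_add {M : ℕ} {α β : ℕ → ℕ} {i r : ℕ} (hr : r < M) :
    doubledValue M α β (i * M + r) =
      if r = 0 then 2 * max (α (i - 1)) (α i)
      else if r = 1 ∨ r + 1 = M then 2 * α i + 1
      else if r % 2 = 0 then 2 * α i
      else 2 * β i := by
  have h1 : (i * M + r) % M = r := by rw [Nat.mul_add_mod', Nat.mod_eq_of_lt hr]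
  have h2 : (i * M + r) / M = i := by
    rw [mul_comm, Nat.mul_add_div (by omega), Nat.div_eq_of_lt hr, add_zero]
  rw [doubledValue, h1, h2]

theorem doubledValue_succ_mul {M : ℕ} {α β : ℕ → ℕ} {i : ℕ} (hM : 0 < M) :
    doubledValue M α β (i * M + M) = 2 * max (α i) (α (i + 1)) := by
  have := doubledValue_add (α := α) (β := β) (i := i + 1) hM
  rw [add_zero, add_mul, one_mul] at this
  simpa using this

theorem doubledValue_mem {N M : ℕ} {α β : ℕ → ℕ} (h : Gluable N α β) {i r : ℕ} (hM : 0 < M)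
    (hr : r ≤ M) :
    2 * α i ≤ doubledValue M α β (i * M + r) ∧ doubledValue M α β (i * M + r) ≤ 2 * β i := by
  have h1 := h.lt i
  have h2 := h.succ_le i
  rcases hr.lt_or_eq with hr | rfl
  · rw [doubledValue_add hr]
    rcases Nat.eq_zero_or_pos i with rfl | hi
    · split_ifs <;> simp <;> omega
    · have h3 := h.le_succ (i - 1)
      rw [Nat.sub_add_cancel hi] at h3
      split_ifs <;> omega
  · rw [doubledValue_succ_mul hM]
    omega

theorem doubledValue_succ_ne {N M : ℕ} {α β : ℕ → ℕ} (h : Gluable N α β) (hM : 6 ≤ M) (k : ℕ) :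
    doubledValue M α β (k + 1) ≠ doubledValue M α β k := by
  obtain ⟨i, r, hr, rfl⟩ : ∃ i r, r < M ∧ k = i * M + r :=
    ⟨k / M, k % M, Nat.mod_lt _ (by omega), (Nat.div_add_mod' k M).symm⟩
  have h1 := h.lt i
  rw [doubledValue_add hr, add_assoc]
  generalize max (α (i - 1)) (α i) = u
  rcases (show r + 1 ≤ M from hr).lt_or_eq with hr' | hr'
  · rw [doubledValue_add hr', if_neg (by omega : ¬ r + 1 = 0)]
    split_ifs <;> omega
  · rw [hr', doubledValue_succ_mul (by omega)]
    split_ifs <;> omega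

theorem zigzag_eq {N M : ℕ} {α β : ℕ → ℕ} {k : ℕ} (hk : k < N * M) {t : ℝ} (h1 : (k : ℝ) ≤ M * t)
    (h2 : M * t ≤ k + 1) :
    zigzag N M α β t = (doubledValue M α β k : ℝ) / 2 +
      ((doubledValue M α β (k + 1) : ℝ) / 2 - (doubledValue M α β k : ℝ) / 2) * (M * t - k) :=
  piecewiseLinear_eq _ hk h1 h2

theorem zigzag_mem {N M : ℕ} {α β : ℕ → ℕ} (h : Gluable N α β) (hM : 0 < M) {i : ℕ} (hi : i < N)
    {t : ℝ} (h1 : (i : ℝ) ≤ t) (h2 : t ≤ i + 1) :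
    zigzag N M α β t ∈ Icc (α i : ℝ) (β i) := by
  obtain ⟨r, hr, hr1, hr2⟩ : ∃ r < M, ((i * M + r : ℕ) : ℝ) ≤ M * t ∧
      M * t ≤ ((i * M + r : ℕ) : ℝ) + 1 := by
    have hM' : (0 : ℝ) < M := by exact_mod_cast hM
    rcases h2.lt_or_eq with h2 | rfl
    · have h0 : 0 ≤ M * (t - i) := mul_nonneg hM'.le (by linarith)
      refine ⟨⌊M * (t - i)⌋₊, ?_, ?_, ?_⟩
      · rw [Nat.floor_lt h0]; nlinarith
      · push_cast; linarith [Nat.floor_le h0]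
      · push_cast; linarith [Nat.lt_floor_add_one (M * (t - i))]
    · refine ⟨M - 1, by omega, ?_, ?_⟩ <;> push_cast [Nat.cast_sub hM] <;> nlinarith
  have hk : i * M + r < N * M := by nlinarith
  rw [zigzag_eq hk hr1 hr2]
  obtain ⟨a1, a2⟩ := doubledValue_mem h (i := i) hM hr.le
  obtain ⟨b1, b2⟩ := doubledValue_mem h (i := i) (r := r + 1) hM hr
  rw [← add_assoc] at b1 b2
  generalize doubledValue M α β (i * M + r) = a at *
  generalize doubledValue M α β (i * M + r + 1) = b at *
  have a1' : 2 * (α i : ℝ) ≤ a := by exact_mod_cast a1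
  have a2' : (a : ℝ) ≤ 2 * β i := by exact_mod_cast a2
  have b1' : 2 * (α i : ℝ) ≤ b := by exact_mod_cast b1
  have b2' : (b : ℝ) ≤ 2 * β i := by exact_mod_cast b2
  constructor <;> nlinarith

theorem zigzag_apply_of_even {N M : ℕ} {α β : ℕ → ℕ} {i r : ℕ} (hi : i < N) (hr : 2 ≤ r)
    (hr' : r + 2 ≤ M) (he : r % 2 = 0) : zigzag N M α β (i + r / M) = α i := by
  have hM : (M : ℝ) ≠ 0 := by norm_cast; omega
  have hk : i * M + r < N * M := by nlinarith
  have ht : (M : ℝ) * (i + r / M) = ((i * M + r : ℕ) : ℝ) := by push_cast; field_simp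
  rw [zigzag_eq hk ht.ge (by rw [ht]; linarith), ht, doubledValue_add (by omega), if_neg (by omega),
    if_neg (by omega), if_pos he]
  push_cast
  ring

theorem zigzag_apply_of_odd {N M : ℕ} {α β : ℕ → ℕ} {i r : ℕ} (hi : i < N) (hr : 2 ≤ r)
    (hr' : r + 2 ≤ M) (ho : r % 2 = 1) : zigzag N M α β (i + r / M) = β i := by
  have hM : (M : ℝ) ≠ 0 := by norm_cast; omega
  have hk : i * M + r < N * M := by nlinarith
  have ht : (M : ℝ) * (i + r / M) = ((i * M + r : ℕ) : ℝ) := by push_cast; field_simp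
  rw [zigzag_eq hk ht.ge (by rw [ht]; linarith), ht, doubledValue_add (by omega), if_neg (by omega),
    if_neg (by omega), if_neg (by omega)]
  push_cast
  ring

/-- Every interval contains a comparatively long interval lying between consecutive integers. -/
theorem exists_subinterval_of_cell {s t : ℝ} (hs : 0 ≤ s) (hst : s < t) :
    ∃ (j : ℕ) (p q : ℝ), s ≤ p ∧ q ≤ t ∧ j ≤ p ∧ q ≤ j + 1 ∧ p < q ∧
      min 1 (t - s) / 2 ≤ q - p := by
  have h1 := Nat.floor_le hs
  have h2 := Nat.lt_floor_add_one s
  have h3 : min 1 (t - s) ≤ 1 := min_le_left _ _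
  have h4 : min 1 (t - s) ≤ t - s := min_le_right _ _
  have h5 : 0 < min 1 (t - s) := lt_min one_pos (by linarith)
  by_cases h : min 1 (t - s) / 2 ≤ ⌊s⌋₊ + 1 - s
  · exact ⟨⌊s⌋₊, s, s + min 1 (t - s) / 2, le_rfl, by linarith, h1, by linarith, by linarith,
      by linarith⟩
  · push Not at h
    refine ⟨⌊s⌋₊ + 1, ⌊s⌋₊ + 1, ⌊s⌋₊ + 1 + min 1 (t - s) / 2, by linarith, by linarith, ?_, ?_,
      by linarith, by linarith⟩ <;> push_cast <;> linarith

theorem exists_subinterval_zigzag_image {N M : ℕ} {α β : ℕ → ℕ} (h : Gluable N α β)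
    (hM : 16 ≤ M) {i : ℕ} (hi : i < N) {p q : ℝ} (hp : (i : ℝ) ≤ p) (hpq : p < q)
    (hq : q ≤ i + 1) :
    ∃ (j : ℕ) (p' q' : ℝ), Covers N α β i j ∧ j ≤ p' ∧ q' ≤ j + 1 ∧ p' < q' ∧
      min (1 / 8) (2 * (q - p)) ≤ q' - p' ∧ Icc p' q' ⊆ zigzag N M α β '' Icc p q := by
  have hM' : (16 : ℝ) ≤ M := by exact_mod_cast hM
  have hi0 : (0 : ℝ) ≤ i := i.cast_nonneg
  have hiN : (i : ℝ) + 1 ≤ N := by exact_mod_cast hi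
  obtain ⟨k, s, t, hs, ht, hks, htk, hst, hlen⟩ :=
    exists_subinterval_of_cell (s := M * p) (t := M * q) (by nlinarith) (by nlinarith)
  have hk : k < N * M := by
    have : (k : ℝ) < N * M := by nlinarith
    exact_mod_cast this
  have hM0 : (0 : ℝ) < M := by linarith
  have hPp : p ≤ s / M := by rw [le_div_iff₀ hM0]; linarith
  have hQq : t / M ≤ q := by rw [div_le_iff₀ hM0]; linarith
  have hPQ : s / M < t / M := by gcongr
  have hMP : M * (s / M) = s := by field_simp
  have hMQ : M * (t / M) = t := by field_simp
  set G := zigzag N M α β with hG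
  have hGP := zigzag_eq (α := α) (β := β) (t := s / M) hk (by linarith) (by linarith)
  have hGQ := zigzag_eq (α := α) (β := β) (t := t / M) hk (by linarith) (by linarith)
  rw [hMP, ← hG] at hGP
  rw [hMQ, ← hG] at hGQ
  have hslope : 1 ≤ |(doubledValue M α β (k + 1) : ℝ) - doubledValue M α β k| := by
    have hne := doubledValue_succ_ne h (by omega : 6 ≤ M) k
    have : 1 ≤ |(doubledValue M α β (k + 1) : ℤ) - doubledValue M α β k| :=
      Int.one_le_abs (sub_ne_zero.2 (by exact_mod_cast hne))
    exact_mod_cast this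
  have hdist : (t - s) / 2 ≤ |G (t / M) - G (s / M)| := by
    have : G (t / M) - G (s / M) =
        ((doubledValue M α β (k + 1) : ℝ) - doubledValue M α β k) * ((t - s) / 2) := by
      rw [hGP, hGQ]; ring
    rw [this, abs_mul, abs_of_pos (by linarith : 0 < (t - s) / 2)]
    nlinarith
  have hmP := zigzag_mem h (by omega : 0 < M) hi (t := s / M) (by linarith) (by linarith)
  have hmQ := zigzag_mem h (by omega : 0 < M) hi (t := t / M) (by linarith) (by linarith)
  rw [← hG] at hmP hmQ
  have hlo : (α i : ℝ) ≤ min (G (s / M)) (G (t / M)) := le_min hmP.1 hmQ.1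
  have hhi : max (G (s / M)) (G (t / M)) ≤ β i := max_le hmP.2 hmQ.2
  rw [← max_sub_min_eq_abs] at hdist
  obtain ⟨j, p', q', h1, h2, h3, h4, h5, h6⟩ := exists_subinterval_of_cell
    ((Nat.cast_nonneg (α i)).trans hlo) (by linarith :
      min (G (s / M)) (G (t / M)) < max (G (s / M)) (G (t / M)))
  refine ⟨j, p', q', ⟨hi, ?_, ?_⟩, h3, h4, h5, ?_, ?_⟩
  · have : (α i : ℝ) < j + 1 := by linarith
    exact Nat.lt_succ_iff.1 (by exact_mod_cast this)
  · have : (j : ℝ) < β i := by linarith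
    exact_mod_cast this
  · refine le_trans ?_ h6
    have hmul : 16 * (q - p) ≤ M * q - M * p := by nlinarith
    rcases min_cases 1 (M * q - M * p) with ⟨e1, e2⟩ | ⟨e1, e2⟩ <;>
    rcases min_cases 1 (max (G (s / M)) (G (t / M)) - min (G (s / M)) (G (t / M)))
      with ⟨e3, e4⟩ | ⟨e3, e4⟩ <;>
    rcases min_cases (1 / 8) (2 * (q - p)) with ⟨e5, e6⟩ | ⟨e5, e6⟩ <;> linarith
  · have himg := intermediate_value_uIcc (f := G) (a := s / M) (b := t / M)
      (continuous_zigzag N M α β).continuousOn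
    intro z hz
    obtain ⟨x, hx, rfl⟩ := himg (show z ∈ uIcc (G (s / M)) (G (t / M)) from
      ⟨h1.trans hz.1, hz.2.trans h2⟩)
    rw [Set.uIcc_of_le hPQ.le] at hx
    exact ⟨x, ⟨hPp.trans hx.1, hx.2.trans hQq⟩, rfl⟩

theorem Icc_subset_zigzag_image {N M : ℕ} {α β : ℕ → ℕ} (hM : 80 ≤ M) {i : ℕ} (hi : i < N)
    {p q : ℝ} (hp : (i : ℝ) ≤ p) (hpq : 1 / 8 ≤ q - p) (hq : q ≤ i + 1) :
    Icc (α i : ℝ) (β i) ⊆ zigzag N M α β '' Icc p q := by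
  have hM' : (80 : ℝ) ≤ M := by exact_mod_cast hM
  have hM0 : (0 : ℝ) < M := by linarith
  have hnn : 0 ≤ M * (p - i) / 2 := by
    have : 0 ≤ M * (p - i) := mul_nonneg hM0.le (by linarith)
    linarith
  have hl : (10 : ℝ) ≤ M * (q - p) := by nlinarith
  have hu : M * (q - i) ≤ M := by nlinarith
  obtain ⟨r, hr⟩ : ∃ r, r = 2 * ⌈M * (p - i) / 2⌉₊ + 2 := ⟨_, rfl⟩
  have h1 := Nat.le_ceil (M * (p - i) / 2)
  have h2 := Nat.ceil_lt_add_one hnn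
  have hrc : (r : ℝ) = 2 * ⌈M * (p - i) / 2⌉₊ + 2 := by rw [hr]; push_cast; ring
  have hrM : r + 3 ≤ M := by
    have : (r : ℝ) + 3 ≤ M := by linarith
    exact_mod_cast this
  have ha := zigzag_apply_of_even (M := M) (α := α) (β := β) hi (by omega) (by omega)
    (by omega : r % 2 = 0)
  have hb := zigzag_apply_of_odd (M := M) (α := α) (β := β) hi (by omega : 2 ≤ r + 1) (by omega)
    (by omega)
  have hle : (i : ℝ) + r / M ≤ i + (r + 1 : ℕ) / M := by gcongr; omega
  have himg := intermediate_value_Icc hle (continuous_zigzag N M α β).continuousOn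
  rw [ha, hb] at himg
  refine himg.trans (Set.image_mono (Set.Icc_subset_Icc ?_ ?_))
  · have : p - i ≤ r / M := by rw [le_div_iff₀ hM0]; linarith
    linarith
  · have : ((r + 1 : ℕ) : ℝ) / M ≤ q - i := by rw [div_le_iff₀ hM0]; push_cast; linarith
    linarith

theorem subset_iterate_image_trans {X : Type*} {G : X → X} {A B C : Set X} {n k : ℕ}
    (h1 : B ⊆ G^[n] '' A) (h2 : C ⊆ G^[k] '' B) : C ⊆ G^[k + n] '' A := by
  rw [Function.iterate_add, Set.image_comp]
  exact h2.trans (Set.image_mono h1)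

theorem Covers.cell_subset {N : ℕ} {α β : ℕ → ℕ} {i j : ℕ} (hij : Covers N α β i j) :
    Icc (j : ℝ) (j + 1) ⊆ Icc (α i : ℝ) (β i) := by
  refine Set.Icc_subset_Icc (by exact_mod_cast hij.2.1) ?_
  have := hij.2.2
  exact_mod_cast this

theorem cell_subset_iterate_image_of_reflTransGen {N M : ℕ} {α β : ℕ → ℕ} (hM : 80 ≤ M) {i j : ℕ}
    (hij : Relation.ReflTransGen (Covers N α β) i j) :
    ∃ n, Icc (j : ℝ) (j + 1) ⊆ (zigzag N M α β)^[n] '' Icc (i : ℝ) (i + 1) := by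
  induction hij with
  | refl => exact ⟨0, by simp⟩
  | tail _ hbc ih =>
    obtain ⟨n, hn⟩ := ih
    refine ⟨1 + n, subset_iterate_image_trans hn ?_⟩
    rw [Function.iterate_one]
    exact hbc.cell_subset.trans
      (Icc_subset_zigzag_image hM hbc.1 le_rfl (by norm_num) le_rfl)

theorem exists_cell_subset_iterate_image {N M : ℕ} {α β : ℕ → ℕ} (h : Gluable N α β)
    (hM : 80 ≤ M) (k : ℕ) {i : ℕ} (hi : i < N) {p q : ℝ} (hp : (i : ℝ) ≤ p) (hpq : p < q)
    (hq : q ≤ i + 1) (hlen : 1 / 8 ≤ 2 ^ k * (q - p)) :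
    ∃ n j, 0 < n ∧ Relation.ReflTransGen (Covers N α β) i j ∧
      Icc (j : ℝ) (j + 1) ⊆ (zigzag N M α β)^[n] '' Icc p q := by
  induction k generalizing i p q with
  | zero =>
    have hc : Covers N α β i (α i) := ⟨hi, le_rfl, h.lt i⟩
    refine ⟨1, α i, one_pos, Relation.ReflTransGen.single hc, ?_⟩
    rw [Function.iterate_one]
    exact hc.cell_subset.trans (Icc_subset_zigzag_image hM hi hp (by linarith) hq)
  | succ k ih =>
    obtain ⟨j, p', q', hc, h1, h2, h3, h4, h5⟩ :=
      exists_subinterval_zigzag_image h (by omega : 16 ≤ M) hi hp hpq hq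
    have hk : (1 : ℝ) ≤ 2 ^ k := one_le_pow₀ (by norm_num)
    have hlen' : 1 / 8 ≤ 2 ^ k * (q' - p') := by
      refine le_trans ?_ (mul_le_mul_of_nonneg_left h4 (by positivity))
      rw [pow_succ] at hlen
      rcases min_cases (1 / 8) (2 * (q - p)) with ⟨e, _⟩ | ⟨e, _⟩ <;> rw [e] <;> linarith
    obtain ⟨n, l, -, hjl, hsub⟩ := ih (hc.lt_card h) h1 h3 h2 hlen'
    refine ⟨n + 1, l, n.succ_pos, Relation.ReflTransGen.head hc hjl, ?_⟩
    exact subset_iterate_image_trans (by rwa [Function.iterate_one]) hsub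

theorem cell_subset_iterate_image {N M : ℕ} {α β : ℕ → ℕ} (h : Gluable N α β) (hM : 80 ≤ M)
    (hrev : ∀ i j, Covers N α β i j → Relation.ReflTransGen (Covers N α β) j i) {i : ℕ}
    (hi : i < N) {p q : ℝ} (hp : (i : ℝ) ≤ p) (hpq : p < q) (hq : q ≤ i + 1) :
    ∃ n, 0 < n ∧ Icc (i : ℝ) (i + 1) ⊆ (zigzag N M α β)^[n] '' Icc p q := by
  obtain ⟨k, hk⟩ := pow_unbounded_of_one_lt (1 / 8 / (q - p)) (one_lt_two (α := ℝ))
  rw [div_lt_iff₀ (by linarith)] at hk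
  obtain ⟨n, j, hn, hij, hsub⟩ := exists_cell_subset_iterate_image h hM k hi hp hpq hq hk.le
  have hji : Relation.ReflTransGen (Covers N α β) j i := by
    clear hsub
    induction hij with
    | refl => exact .refl
    | tail _ hbc ih => exact (hrev _ _ hbc).trans ih
  obtain ⟨l, hl⟩ := cell_subset_iterate_image_of_reflTransGen hM hji
  exact ⟨l + n, by omega, subset_iterate_image_trans hsub hl⟩

/-- The index of the cell `[i / N, (i + 1) / N]` containing `x`. -/
noncomputable def cellIndex (N : ℕ) (x : unitI) : ℕ := min ⌊(N : ℝ) * x⌋₊ (N - 1)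

theorem cellIndex_lt {N : ℕ} (hN : 0 < N) (x : unitI) : cellIndex N x < N :=
  (min_le_right _ _).trans_lt (by omega)

theorem cellIndex_le {N : ℕ} (x : unitI) : (cellIndex N x : ℝ) ≤ N * x :=
  le_trans (by exact_mod_cast min_le_left _ _)
    (Nat.floor_le (mul_nonneg N.cast_nonneg x.2.1))

theorem le_cellIndex_add_one {N : ℕ} (hN : 0 < N) (x : unitI) :
    (N : ℝ) * x ≤ cellIndex N x + 1 := by
  rcases min_cases ⌊(N : ℝ) * x⌋₊ (N - 1) with ⟨h, _⟩ | ⟨h, _⟩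
  · rw [cellIndex, h]
    exact (Nat.lt_floor_add_one _).le
  · rw [cellIndex, h, Nat.cast_sub hN]
    push_cast
    have := mul_le_mul_of_nonneg_left x.2.2 (Nat.cast_nonneg (α := ℝ) N)
    linarith

theorem cellIndex_mono (N : ℕ) : Monotone (cellIndex N) := fun _ _ hxy =>
  min_le_min_right _ (Nat.floor_mono (mul_le_mul_of_nonneg_left hxy N.cast_nonneg))

theorem cellIndex_eq {N i : ℕ} (hi : i < N) {x : unitI} (h1 : (i : ℝ) ≤ N * x)
    (h2 : (N : ℝ) * x < i + 1) : cellIndex N x = i := by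
  have : ⌊(N : ℝ) * x⌋₊ = i :=
    (Nat.floor_eq_iff (mul_nonneg N.cast_nonneg x.2.1)).2 ⟨h1, h2⟩
  rw [cellIndex, this]
  omega

/-- Some periodic point of `f` moves from the cell `i` to the cell `j`. -/
def PeriodicStep (N : ℕ) (f : unitI → unitI) (i j : ℕ) : Prop :=
  ∃ q ∈ periodicPts f, cellIndex N q = i ∧ cellIndex N (f q) = j

theorem PeriodicStep.reflTransGen_symm {N : ℕ} {f : unitI → unitI} {i j : ℕ}
    (h : PeriodicStep N f i j) : Relation.ReflTransGen (PeriodicStep N f) j i := by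
  obtain ⟨q, ⟨n, hn, hq⟩, rfl, rfl⟩ := h
  have chain : ∀ k, Relation.ReflTransGen (PeriodicStep N f) (cellIndex N (f q))
      (cellIndex N (f^[k + 1] q)) := by
    intro k
    induction k with
    | zero => exact .refl
    | succ k ih =>
      refine ih.tail ⟨f^[k + 1] q, ⟨n, hn, hq.apply_iterate _⟩, rfl, ?_⟩
      rw [← Function.iterate_succ_apply' f]
  have := chain (n - 1)
  rwa [Nat.sub_add_cancel hn, hq.eq] at this

theorem PeriodicStep.of_between {N : ℕ} {f : C(unitI, unitI)} (hf : f ∈ CP) {i a b j : ℕ}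
    (ha : PeriodicStep N f i a) (hb : PeriodicStep N f i b) (haj : a < j) (hjb : j < b) :
    PeriodicStep N f i j := by
  obtain ⟨q₁, -, hq₁, rfl⟩ := ha
  obtain ⟨q₂, -, hq₂, rfl⟩ := hb
  have hN : 0 < N := by
    rcases Nat.eq_zero_or_pos N with rfl | h
    · simp [cellIndex] at haj hjb
    · exact h
  have hN' : (0 : ℝ) < N := by exact_mod_cast hN
  have hjN : j < N := hjb.trans (cellIndex_lt hN _)
  have h1 : (N : ℝ) * f q₁ ≤ j := (le_cellIndex_add_one hN _).trans (by exact_mod_cast haj)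
  have h2 : (j : ℝ) + 1 ≤ N * f q₂ := le_trans (by exact_mod_cast hjb) (cellIndex_le _)
  have hcont : Continuous fun x : unitI => (N : ℝ) * f x := by fun_prop
  obtain ⟨x, hx, hxj⟩ := intermediate_value_uIcc (a := q₁) (b := q₂) hcont.continuousOn
    (show (j : ℝ) + 1 / 2 ∈ uIcc ((N : ℝ) * f q₁) (N * f q₂) from by
      rw [Set.mem_uIcc]; left; constructor <;> linarith)
  simp only at hxj
  have hx₁ : x ≠ q₁ := by rintro rfl; linarith
  have hx₂ : x ≠ q₂ := by rintro rfl; linarith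
  have hopen : IsOpen (Ioo (min q₁ q₂) (max q₁ q₂) ∩ (fun x : unitI => (N : ℝ) * f x) ⁻¹'
      Ioo (j : ℝ) (j + 1)) := isOpen_Ioo.inter (isOpen_Ioo.preimage hcont)
  obtain ⟨q, ⟨⟨hq1, hq2⟩, hq3, hq4⟩, hq⟩ := hf.2.inter_open_nonempty _ hopen ⟨x, ⟨
    lt_of_le_of_ne hx.1 fun h => by
      rcases min_choice q₁ q₂ with e | e
      · exact hx₁ (by rw [← h, e])
      · exact hx₂ (by rw [← h, e]),
    lt_of_le_of_ne hx.2 fun h => by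
      rcases max_choice q₁ q₂ with e | e
      · exact hx₁ (by rw [h, e])
      · exact hx₂ (by rw [h, e])⟩, by
    constructor <;> simp only [hxj] <;> linarith⟩
  refine ⟨q, hq, ?_, cellIndex_eq hjN hq3.le hq4⟩
  have e1 := cellIndex_mono N hq1.le
  have e2 := cellIndex_mono N hq2.le
  rw [(cellIndex_mono N).map_min, hq₁, hq₂, min_self] at e1
  rw [(cellIndex_mono N).map_max, hq₁, hq₂, max_self] at e2
  omega

theorem exists_periodicPt_cell {N : ℕ} {f : C(unitI, unitI)} (hf : f ∈ CP) (hN : 0 < N) {s t : ℝ}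
    (hs : 0 ≤ s) (hst : s < t) (ht : t ≤ N) :
    ∃ q ∈ periodicPts f, s < N * (q : ℝ) ∧ N * (q : ℝ) < t := by
  have hN' : (0 : ℝ) < N := by exact_mod_cast hN
  obtain ⟨q, hq, h1, h2⟩ := exists_mem_between_of_dense hf.2 (a := s / N) (b := t / N)
    (by positivity) (by gcongr) (by rw [div_le_one hN']; exact ht)
  rw [div_lt_iff₀ hN'] at h1
  rw [lt_div_iff₀ hN'] at h2
  exact ⟨q, hq, by linarith, by linarith⟩

theorem exists_periodicStep {N : ℕ} {f : C(unitI, unitI)} (hf : f ∈ CP) {i : ℕ} (hi : i < N) :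
    ∃ j, PeriodicStep N f i j := by
  obtain ⟨q, hq, h1, h2⟩ := exists_periodicPt_cell hf (by omega : 0 < N) (s := i) (t := i + 1)
    i.cast_nonneg (by linarith) (by exact_mod_cast hi)
  exact ⟨_, q, hq, cellIndex_eq hi h1.le h2, rfl⟩

theorem exists_periodicStep_iff {N : ℕ} {f : C(unitI, unitI)} (hf : f ∈ CP) {i : ℕ} (hi : i < N) :
    ∃ a b, a < b ∧ b ≤ N ∧ ∀ j, PeriodicStep N f i j ↔ a ≤ j ∧ j < b := by
  classical
  have hlt : ∀ j, PeriodicStep N f i j → j < N := by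
    rintro _ ⟨q, -, -, rfl⟩
    exact cellIndex_lt (by omega) _
  have hex := exists_periodicStep hf hi
  let s := (Finset.range N).filter (PeriodicStep N f i)
  have hmem : ∀ j, j ∈ s ↔ PeriodicStep N f i j := fun j => by
    simpa [s] using hlt j
  have hs : s.Nonempty := hex.imp fun j hj => (hmem j).2 hj
  have hmin := (hmem _).1 (s.min'_mem hs)
  have hmax := (hmem _).1 (s.max'_mem hs)
  refine ⟨s.min' hs, s.max' hs + 1, Nat.lt_succ_of_le (s.min'_le_max' hs), hlt _ hmax,
    fun j => ⟨fun hj => ⟨s.min'_le _ ((hmem j).2 hj),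
      Nat.lt_succ_of_le (s.le_max' _ ((hmem j).2 hj))⟩, fun ⟨h1, h2⟩ => ?_⟩⟩
  rcases h1.eq_or_lt with h1 | h1
  · exact h1 ▸ hmin
  rcases (Nat.le_of_lt_succ h2).eq_or_lt with h2 | h2
  · exact h2 ▸ hmax
  exact hmin.of_between hf hmax h1 h2

/-- Neighbouring cells contain periodic points whose images lie in almost neighbouring cells. -/
theorem exists_periodicStep_neighbours {N : ℕ} {f : C(unitI, unitI)} (hf : f ∈ CP) {i : ℕ}
    (hi : i + 1 < N) : ∃ a b, PeriodicStep N f i a ∧ PeriodicStep N f (i + 1) b ∧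
      a ≤ b + 1 ∧ b ≤ a + 1 := by
  have hN : 0 < N := by omega
  have hN' : (0 : ℝ) < N := by exact_mod_cast hN
  have hi' : (i : ℝ) + 1 + 1 ≤ N := by exact_mod_cast hi
  have hi0 : (0 : ℝ) ≤ i := i.cast_nonneg
  obtain ⟨δ, hδ, hδf⟩ := Metric.uniformContinuous_iff.1
    (CompactSpace.uniformContinuous_of_continuous f.continuous) (1 / N) (by positivity)
  have hη : 0 < min 1 (N * δ / 2) := by positivity
  have hη1 : min 1 (N * δ / 2) ≤ 1 := min_le_left _ _
  have hη2 : min 1 (N * δ / 2) ≤ N * δ / 2 := min_le_right _ _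
  generalize min 1 (N * δ / 2) = η at *
  obtain ⟨q, hq, h1, h2⟩ := exists_periodicPt_cell hf hN (s := i + 1 - η) (t := i + 1)
    (by linarith) (by linarith) (by linarith)
  obtain ⟨q', hq', h1', h2'⟩ := exists_periodicPt_cell hf hN (s := i + 1) (t := i + 1 + η)
    (by linarith) (by linarith) (by linarith)
  refine ⟨_, _, ⟨q, hq, cellIndex_eq (by omega) (by linarith) h2, rfl⟩, ⟨q', hq',
    cellIndex_eq hi (by push_cast; linarith) (by push_cast; linarith), rfl⟩, ?_⟩
  have hd : dist q q' < δ := by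
    rw [Subtype.dist_eq, Real.dist_eq, abs_lt]
    constructor <;> nlinarith
  have hfd := hδf hd
  rw [Subtype.dist_eq, Real.dist_eq, lt_div_iff₀ hN', ← abs_of_pos hN', ← abs_mul,
    abs_lt] at hfd
  have a1 := cellIndex_le (N := N) (f q)
  have a2 := le_cellIndex_add_one hN (f q)
  have b1 := cellIndex_le (N := N) (f q')
  have b2 := le_cellIndex_add_one hN (f q')
  constructor
  · have : (cellIndex N (f q) : ℝ) < (cellIndex N (f q') + 1 : ℕ) + 1 := by push_cast; linarith
    exact Nat.le_of_lt_succ (by exact_mod_cast this)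
  · have : (cellIndex N (f q') : ℝ) < (cellIndex N (f q) + 1 : ℕ) + 1 := by push_cast; linarith
    exact Nat.le_of_lt_succ (by exact_mod_cast this)

theorem exists_gluable_periodicStep {N : ℕ} {f : C(unitI, unitI)} (hf : f ∈ CP) (hN : 0 < N) :
    ∃ α β : ℕ → ℕ, Gluable N α β ∧ ∀ i j, Covers N α β i j ↔ PeriodicStep N f i j := by
  choose α β hlt hle hiff using fun i : ℕ =>
    exists_periodicStep_iff hf (show min i (N - 1) < N by omega)
  have hiff' : ∀ i < N, ∀ j, PeriodicStep N f i j ↔ α i ≤ j ∧ j < β i := by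
    intro i hi j
    have := hiff i j
    rwa [min_eq_left (by omega)] at this
  have hglue : ∀ i, α i ≤ β (i + 1) ∧ α (i + 1) ≤ β i := by
    intro i
    rcases lt_or_ge (i + 1) N with hi | hi
    · obtain ⟨a, b, ha, hb, h1, h2⟩ := exists_periodicStep_neighbours hf hi
      rw [hiff' i (by omega)] at ha
      rw [hiff' (i + 1) hi] at hb
      omega
    · have e1 := hiff i
      have e2 := hiff (i + 1)
      rw [min_eq_right (by omega)] at e1 e2
      have h1 := (e1 (α i)).2 ⟨le_rfl, hlt i⟩
      have h2 := (e2 (α (i + 1))).2 ⟨le_rfl, hlt (i + 1)⟩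
      rw [e2] at h1
      rw [e1] at h2
      omega
  refine ⟨α, β, ⟨hlt, hle, fun i => (hglue i).1, fun i => (hglue i).2⟩, fun i j => ⟨fun h =>
    (hiff' i h.1 j).2 h.2, fun h => ?_⟩⟩
  have hi : i < N := by
    obtain ⟨q, -, rfl, -⟩ := h
    exact cellIndex_lt hN q
  exact ⟨hi, (hiff' i hi j).1 h⟩

theorem zigzag_mul_mem {N M : ℕ} {α β : ℕ → ℕ} (h : Gluable N α β) (hN : 0 < N) (hM : 0 < M)
    (x : unitI) :
    zigzag N M α β (N * x) ∈ Icc (α (cellIndex N x) : ℝ) (β (cellIndex N x)) :=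
  zigzag_mem h hM (cellIndex_lt hN x) (cellIndex_le x) (le_cellIndex_add_one hN x)

theorem exists_map_zigzag {N M : ℕ} {α β : ℕ → ℕ} (h : Gluable N α β) (hN : 0 < N) (hM : 0 < M) :
    ∃ g : C(unitI, unitI), ∀ x, (N : ℝ) * g x = zigzag N M α β (N * x) := by
  have hN' : (0 : ℝ) < N := by exact_mod_cast hN
  have hmem : ∀ x : unitI, zigzag N M α β (N * x) / N ∈ Icc (0 : ℝ) 1 := by
    intro x
    obtain ⟨h1, h2⟩ := zigzag_mul_mem h hN hM x
    have h3 : (β (cellIndex N x) : ℝ) ≤ N := by exact_mod_cast h.le_card _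
    refine ⟨div_nonneg ((Nat.cast_nonneg _).trans h1) hN'.le, ?_⟩
    rw [div_le_one hN']
    linarith
  refine ⟨⟨fun x => ⟨_, hmem x⟩, Continuous.subtype_mk (((continuous_zigzag N M α β).comp
    (continuous_const.mul continuous_subtype_val)).div_const _) _⟩, fun x => ?_⟩
  simp only [ContinuousMap.coe_mk]
  field_simp

theorem mem_crossingMaps_of_zigzag {N M : ℕ} {α β : ℕ → ℕ} (h : Gluable N α β) (hN : 0 < N)
    (hM : 80 ≤ M)
    (hrev : ∀ i j, Covers N α β i j → Relation.ReflTransGen (Covers N α β) j i)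
    {g : C(unitI, unitI)} (hg : ∀ x, (N : ℝ) * g x = zigzag N M α β (N * x)) {a b : ℝ}
    (ha : 0 ≤ a) (hab : a < b) (hb : b ≤ 1) : g ∈ crossingMaps a b := by
  have hN' : (0 : ℝ) < N := by exact_mod_cast hN
  have hiter : ∀ n x, (N : ℝ) * g^[n] x = (zigzag N M α β)^[n] (N * x) := fun n x =>
    (Function.Semiconj.iterate_right (f := fun x : unitI => (N : ℝ) * x) hg n) x
  obtain ⟨j, p, q, h1, h2, h3, h4, h5, -⟩ := exists_subinterval_of_cell
    (s := N * a) (t := N * b) (by positivity) (by gcongr)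
  have hj : j < N := by
    have : (j : ℝ) < N := by nlinarith
    exact_mod_cast this
  obtain ⟨n, hn, hsub⟩ := cell_subset_iterate_image h hM hrev hj (p := p + (q - p) / 3)
    (q := q - (q - p) / 3) (by linarith) (by linarith) (by linarith)
  have hpre : ∀ z ∈ Icc (j : ℝ) (j + 1), ∃ x : unitI, a < x ∧ (x : ℝ) < b ∧ j < N * (x : ℝ) ∧
      N * (x : ℝ) < j + 1 ∧ N * (g^[n] x : ℝ) = z := by
    intro z hz
    obtain ⟨X, ⟨hX1, hX2⟩, hX⟩ := hsub hz
    have e1 : a < X / N := by rw [lt_div_iff₀ hN']; linarith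
    have e2 : X / N < b := by rw [div_lt_iff₀ hN']; linarith
    have e3 : N * (X / N) = X := by field_simp
    refine ⟨⟨X / N, by linarith, by linarith⟩, e1, e2, ?_, ?_, ?_⟩
    · simp only [e3]; linarith
    · simp only [e3]; linarith
    · rw [hiter]; simp only [e3, hX]
  obtain ⟨x, hx1, hx2, hx3, -, hx⟩ := hpre j ⟨le_rfl, by linarith⟩
  obtain ⟨y, hy1, hy2, -, hy4, hy⟩ := hpre (j + 1) ⟨by linarith, le_rfl⟩
  refine ⟨n, x, y, hn, hx1, hx2, hy1, hy2, ?_, ?_⟩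
  · exact Subtype.coe_lt_coe.1 <| lt_of_mul_lt_mul_left (show (N : ℝ) * (g^[n] x : ℝ) < N * x by rwa [hx]) hN'.le
  · exact Subtype.coe_lt_coe.1 <| lt_of_mul_lt_mul_left (show (N : ℝ) * y < N * (g^[n] y : ℝ) by rwa [hy]) hN'.le

theorem mem_horseshoeMaps_of_zigzag {N m M : ℕ} {α β : ℕ → ℕ} (hM : 2 * m + 6 ≤ M) {i : ℕ}
    (hi : Covers N α β i i) {g : C(unitI, unitI)}
    (hg : ∀ x, (N : ℝ) * g x = zigzag N M α β (N * x)) : g ∈ horseshoeMaps m := by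
  have hiN := hi.1
  have hiN' : (i : ℝ) + 1 ≤ N := by exact_mod_cast hiN
  have hi0 : (0 : ℝ) ≤ i := i.cast_nonneg
  have hN' : (0 : ℝ) < N := by linarith
  have hM' : (0 : ℝ) < M := by norm_cast; omega
  let P : ℕ → unitI := fun r => projIcc 0 1 zero_le_one ((i + r / M) / N)
  have hP : ∀ r ≤ M, (N : ℝ) * P r = i + r / M := by
    intro r hr
    have h0 : (0 : ℝ) ≤ r / M := by positivity
    have h1 : (r : ℝ) / M ≤ 1 := by rw [div_le_one hM']; exact_mod_cast hr
    have hmem : ((i : ℝ) + r / M) / N ∈ Icc (0 : ℝ) 1 :=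
      ⟨by positivity, by rw [div_le_one hN']; linarith⟩
    simp only [P, projIcc_of_mem _ hmem]
    field_simp
  have hlt : ∀ r s, r < s → s ≤ M → P r < P s := by
    intro r s hrs hs
    refine Subtype.coe_lt_coe.1 <| lt_of_mul_lt_mul_left (show (N : ℝ) * P r < N * P s from ?_) hN'.le
    rw [hP r (by omega), hP s hs]
    gcongr
  have hP0 : (N : ℝ) * P 0 = i := by simp [hP 0 (Nat.zero_le _)]
  have hPM : (N : ℝ) * P M = i + 1 := by rw [hP M le_rfl, div_self hM'.ne']
  have heven : ∀ r, 2 ≤ r → r + 2 ≤ M → r % 2 = 0 → g (P r) ≤ P 0 := by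
    intro r h1 h2 h3
    refine Subtype.coe_le_coe.1 <| le_of_mul_le_mul_left (show (N : ℝ) * g (P r) ≤ N * P 0 from ?_) hN'
    rw [hg, hP r (by omega), zigzag_apply_of_even hiN h1 h2 h3, hP0]
    exact_mod_cast hi.2.1
  have hodd : ∀ r, 2 ≤ r → r + 2 ≤ M → r % 2 = 1 → P M ≤ g (P r) := by
    intro r h1 h2 h3
    refine Subtype.coe_le_coe.1 <| le_of_mul_le_mul_left (show (N : ℝ) * P M ≤ N * g (P r) from ?_) hN'
    rw [hg, hP r (by omega), zigzag_apply_of_odd hiN h1 h2 h3, hPM]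
    have := hi.2.2
    exact_mod_cast this
  refine ⟨P 1, P (M - 1), fun k => P (2 * k + 2), fun k => P (2 * k + 3), fun k hk => ⟨?_, ?_, ?_,
    ?_, ?_, ?_⟩⟩
  · exact (hlt _ _ (by omega) (by omega)).le
  · exact (hlt _ _ (by omega) (by omega)).le
  · exact (hlt _ _ (by omega) (by omega)).le
  · exact hlt _ _ (by omega) (by omega)
  · exact (heven _ (by omega) (by omega) (by omega)).trans_lt (hlt _ _ (by omega) (by omega))
  · exact (hlt _ _ (by omega) le_rfl).trans_le (hodd _ (by omega) (by omega) (by omega))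

theorem exists_covers_self {N : ℕ} {f : C(unitI, unitI)} {α β : ℕ → ℕ}
    (hiff : ∀ i j, Covers N α β i j ↔ PeriodicStep N f i j) : ∃ i, Covers N α β i i := by
  obtain ⟨z, -, hz⟩ := exists_mem_Icc_isFixedPt (a := (0 : unitI)) (b := 1) (f := f)
    f.continuous.continuousOn zero_le_one (f 0).2.1 (f 1).2.2
  exact ⟨cellIndex N z, (hiff _ _).2 ⟨z, ⟨1, one_pos, by simpa [IsPeriodicPt] using hz⟩, rfl,
    by rw [hz.eq]⟩⟩

/-- If `f` oscillates by less than `ε / 4` on the cells of a fine grid, then a zigzag following the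
periodic points of `f` is `ε`-close to `f`. -/
theorem dist_lt_of_zigzag {N M : ℕ} {f g : C(unitI, unitI)} {α β : ℕ → ℕ} (h : Gluable N α β)
    (hN : 0 < N) (hM : 0 < M) (hiff : ∀ i j, Covers N α β i j ↔ PeriodicStep N f i j)
    (hg : ∀ x, (N : ℝ) * g x = zigzag N M α β (N * x)) {ε : ℝ} (hε : 0 < ε) (hNε : 4 < N * ε)
    (hosc : ∀ x y : unitI, N * dist x y ≤ 1 → dist (f x) (f y) < ε / 4) : dist f g < ε := by
  have hN' : (0 : ℝ) < N := by exact_mod_cast hN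
  rw [ContinuousMap.dist_lt_iff hε]
  intro x
  have hi := cellIndex_lt hN x
  have hx1 := cellIndex_le (N := N) x
  have hx2 := le_cellIndex_add_one hN x
  obtain ⟨hG1, hG2⟩ := zigzag_mul_mem h hN hM x
  rw [← hg] at hG1 hG2
  generalize cellIndex N x = i at *
  have hαβ := h.lt i
  have hcell : ∀ q : unitI, cellIndex N q = i → |N * (f x : ℝ) - N * f q| < N * ε / 4 := by
    rintro q rfl
    have h1 := cellIndex_le (N := N) q
    have h2 := le_cellIndex_add_one hN q
    have := hosc x q (by
      rw [Subtype.dist_eq, Real.dist_eq, ← abs_of_pos hN', ← abs_mul, abs_le]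
      constructor <;> linarith)
    rw [Subtype.dist_eq, Real.dist_eq] at this
    rw [← mul_sub, abs_mul, abs_of_pos hN']
    nlinarith
  obtain ⟨q, -, hq, hfq⟩ := (hiff i (α i)).1 ⟨hi, le_rfl, hαβ⟩
  obtain ⟨q', -, hq', hfq'⟩ := (hiff i (β i - 1)).1 ⟨hi, by omega, by omega⟩
  have e1 := abs_lt.1 (hcell q hq)
  have e2 := abs_lt.1 (hcell q' hq')
  have a1 := cellIndex_le (N := N) (f q)
  have a2 := le_cellIndex_add_one hN (f q)
  have b1 := cellIndex_le (N := N) (f q')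
  have b2 := le_cellIndex_add_one hN (f q')
  rw [hfq] at a1 a2
  rw [hfq', Nat.cast_sub (by omega)] at b1 b2
  push_cast at b1 b2
  have : |N * (f x : ℝ) - N * g x| < N * ε := by
    rw [abs_lt]; constructor <;> linarith
  rw [← mul_sub, abs_mul, abs_of_pos hN'] at this
  rw [Subtype.dist_eq, Real.dist_eq]
  exact lt_of_mul_lt_mul_left this hN'.le

theorem exists_dist_lt_mem_horseshoeMaps {f : C(unitI, unitI)} (hf : f ∈ CP) {ε : ℝ} (hε : 0 < ε)
    (m : ℕ) : ∃ g : C(unitI, unitI), dist f g < ε ∧ g ∈ horseshoeMaps m ∧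
      ∀ a b : ℝ, 0 ≤ a → a < b → b ≤ 1 → g ∈ crossingMaps a b := by
  obtain ⟨δ, hδ, hδf⟩ := Metric.uniformContinuous_iff.1
    (CompactSpace.uniformContinuous_of_continuous f.continuous) (ε / 4) (by positivity)
  obtain ⟨N, hNlarge⟩ := exists_nat_gt (max (1 / δ) (4 / ε))
  obtain ⟨hNδ, hNε⟩ := max_lt_iff.1 hNlarge
  have hN' : (0 : ℝ) < N := lt_trans (by positivity) hNδ
  have hN : 0 < N := by exact_mod_cast hN'
  rw [div_lt_iff₀ hδ] at hNδ
  rw [div_lt_iff₀ hε] at hNε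
  obtain ⟨α, β, hglue, hiff⟩ := exists_gluable_periodicStep hf hN
  obtain ⟨g, hg⟩ := exists_map_zigzag (M := 2 * m + 80) hglue hN (by omega)
  have hrel : Covers N α β = PeriodicStep N f := by
    ext i j
    exact hiff i j
  obtain ⟨i, hi⟩ := exists_covers_self hiff
  refine ⟨g, dist_lt_of_zigzag hglue hN (by omega) hiff hg hε hNε fun x y hxy => hδf ?_,
    mem_horseshoeMaps_of_zigzag (by omega) hi hg, fun a b ha hab hb =>
    mem_crossingMaps_of_zigzag hglue hN (by omega) (fun i j hij => ?_) hg ha hab hb⟩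
  · exact lt_of_mul_lt_mul_left (hxy.trans_lt hNδ) hN'.le
  · rw [hrel] at hij ⊢
    exact hij.reflTransGen_symm

/-- Maps with horseshoes of every order and strict diagonal crossings in every subinterval. -/
def genericMaps : Set C(unitI, unitI) :=
  (⋂ m, horseshoeMaps m) ∩
    ⋂ (p : {p : ℚ × ℚ // 0 ≤ p.1 ∧ p.1 < p.2 ∧ p.2 ≤ 1}), crossingMaps p.1.1 p.1.2

theorem genericMaps_subset_CP : genericMaps ⊆ CP := fun _ hf =>
  mem_CP_of_forall_mem_crossingMaps fun a b ha hab hb =>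
    Set.mem_iInter.1 hf.2 ⟨(a, b), ha, hab, hb⟩

theorem isGδ_genericMaps : IsGδ genericMaps :=
  (IsGδ.iInter fun m => (isOpen_horseshoeMaps m).isGδ).inter
    (IsGδ.iInter fun _ => (isOpen_crossingMaps _ _).isGδ)

theorem hTop_eq_top_of_mem_genericMaps {f : C(unitI, unitI)} (hf : f ∈ genericMaps) :
    hTop f = ⊤ :=
  hTop_eq_top_of_forall_mem_horseshoeMaps (Set.mem_iInter.1 hf.1)

/-- An open set of maps meeting every ball around a map of `CP` in a map of `CP` is dense in the
closure of `CP`. -/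
theorem dense_preimage_closure_CP {U : Set C(unitI, unitI)}
    (h : ∀ f ∈ CP, ∀ ε > 0, ∃ g ∈ CP, dist f g < ε ∧ g ∈ U) :
    Dense ((↑) ⁻¹' U : Set (closure CP : Set C(unitI, unitI))) := by
  rw [Metric.dense_iff]
  rintro ⟨f, hf⟩ ε hε
  obtain ⟨f', hf', hd⟩ := Metric.mem_closure_iff.1 hf (ε / 2) (by positivity)
  obtain ⟨g, hg, hd', hgU⟩ := h f' hf' (ε / 2) (by positivity)
  refine ⟨⟨g, subset_closure hg⟩, ?_, hgU⟩
  rw [Metric.mem_ball, dist_comm, Subtype.dist_eq]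
  linarith [dist_triangle f f' g]

theorem dense_genericMaps_closure :
    Dense ((↑) ⁻¹' genericMaps : Set (closure CP : Set C(unitI, unitI))) := by
  have hclosed : IsClosed (closure CP) := isClosed_closure
  have key : ∀ f ∈ CP, ∀ ε > 0, ∀ m, ∃ g ∈ CP, dist f g < ε ∧ g ∈ horseshoeMaps m ∧
      ∀ a b : ℝ, 0 ≤ a → a < b → b ≤ 1 → g ∈ crossingMaps a b := by
    intro f hf ε hε m
    obtain ⟨g, h1, h2, h3⟩ := exists_dist_lt_mem_horseshoeMaps hf hε m
    refine ⟨g, mem_CP_of_forall_mem_crossingMaps fun a b ha hab hb => ?_, h1, h2, h3⟩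
    exact h3 a b (by exact_mod_cast ha) (by exact_mod_cast hab) (by exact_mod_cast hb)
  rw [genericMaps, Set.preimage_inter, Set.preimage_iInter, Set.preimage_iInter]
  refine Dense.inter_of_Gδ (IsGδ.iInter fun m => ((isOpen_horseshoeMaps m).preimage
    continuous_subtype_val).isGδ) (IsGδ.iInter fun _ => ((isOpen_crossingMaps _ _).preimage
    continuous_subtype_val).isGδ) (dense_iInter_of_isOpen (fun m => (isOpen_horseshoeMaps m).preimage
    continuous_subtype_val) fun m => ?_) (dense_iInter_of_isOpen
    (fun _ => (isOpen_crossingMaps _ _).preimage continuous_subtype_val) fun p => ?_)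
  · refine dense_preimage_closure_CP fun f hf ε hε => ?_
    obtain ⟨g, hg, hd, hgm, -⟩ := key f hf ε hε m
    exact ⟨g, hg, hd, hgm⟩
  · obtain ⟨⟨a, b⟩, ha, hab, hb⟩ := p
    refine dense_preimage_closure_CP fun f hf ε hε => ?_
    obtain ⟨g, hg, hd, -, hgc⟩ := key f hf ε hε 0
    exact ⟨g, hg, hd, hgc a b (by exact_mod_cast ha) (by exact_mod_cast hab)
      (by exact_mod_cast hb)⟩

theorem dense_genericMaps_CP :
    Dense ((↑) ⁻¹' genericMaps : Set (CP : Set C(unitI, unitI))) := by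
  rw [Metric.dense_iff]
  rintro ⟨f, hf⟩ ε hε
  obtain ⟨⟨g, hg⟩, hd, hgen⟩ :=
    Metric.dense_iff.1 dense_genericMaps_closure ⟨f, subset_closure hf⟩ ε hε
  exact ⟨⟨g, genericMaps_subset_CP hgen⟩, hd, hgen⟩

/-- The set of maps with infinite topological entropy is residual (contains a dense
`Gδ`) both in `(CP, ρ)` and in `(cl(CP), ρ)`. -/
theorem entropy_infinite_residual :
    (∃ S : Set (CP : Set C(unitI, unitI)),
        IsGδ S ∧ Dense S ∧ ∀ f ∈ S, hTop ⇑(f : C(unitI, unitI)) = ⊤) ∧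
    (∃ S : Set (closure CP : Set C(unitI, unitI)),
        IsGδ S ∧ Dense S ∧ ∀ f ∈ S, hTop ⇑(f : C(unitI, unitI)) = ⊤) := by
  exact ⟨⟨_, isGδ_genericMaps.preimage continuous_subtype_val, dense_genericMaps_CP,
      fun _ hf => hTop_eq_top_of_mem_genericMaps hf⟩,
    ⟨_, isGδ_genericMaps.preimage continuous_subtype_val, dense_genericMaps_closure,
      fun _ hf => hTop_eq_top_of_mem_genericMaps hf⟩⟩
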